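/- Assume q ≥ m and let α ∈ Ĥ(Q). The following are equivalent: (i) α ∈ Γ̂(Q); (ii) ∇_i^m(α) = {α} for all i ∈ {1, ..., m}; (iii) ∇_i^m(α) = {α} for some i ∈ {1, ..., m}; (iv) ℓ(D_α) = ℓ(D_α − Q_1 − Q_2 − ... − Q_m) + 1. -/

import Mathlib

open scoped Classical

/-- Abstract divisor-theoretic data of a nonsingular, projective, geometrically
irreducible algebraic curve over a field `Fq`: a function field `K`, a set of
closed points with their degrees, a genus, and the normalized discrete
valuations of `K` at the closed points (with the junk convention `v P 0 = 0`). -/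
structure Curve (Fq : Type) [Field Fq] where
  /-- the function field of the curve -/
  K : Type
  [fieldK : Field K]
  [algebraK : Algebra Fq K]
  /-- the closed points of the curve -/
  Point : Type
  /-- the degree of a closed point -/
  deg : Point → ℕ
  deg_pos : ∀ P, 0 < deg P
  /-- the genus of the curve -/
  genus : ℕ
  /-- the normalized discrete valuation at a closed point -/
  v : Point → K → ℤ
  v_zero : ∀ P, v P 0 = 0
  v_mul : ∀ (P : Point) {x y : K}, x ≠ 0 → y ≠ 0 → v P (x * y) = v P x + v P y
  v_min_le_add : ∀ (P : Point) {x y : K}, x ≠ 0 → y ≠ 0 → x + y ≠ 0 →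
    min (v P x) (v P y) ≤ v P (x + y)
  v_algebraMap : ∀ (P : Point) (c : Fq), c ≠ 0 → v P (algebraMap Fq K c) = 0
  v_surjective : ∀ P : Point, ∃ x : K, x ≠ 0 ∧ v P x = 1
  /-- a nonzero function has only finitely many zeros and poles -/
  support_finite : ∀ {x : K}, x ≠ 0 → {P : Point | v P x ≠ 0}.Finite
  /-- a function without poles is constant (the curve is projective and
  geometrically irreducible) -/
  no_pole_constant : ∀ {x : K}, x ≠ 0 → (∀ P, 0 ≤ v P x) → ∃ c : Fq, x = algebraMap Fq K c
  /-- principal divisors have degree zero -/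
  degree_principal : ∀ {x : K}, x ≠ 0 → ∑ᶠ P : Point, (deg P : ℤ) * v P x = 0

attribute [instance] Curve.fieldK Curve.algebraK

namespace Curve

variable {Fq : Type} [Field Fq] [Fintype Fq]

/-- The degree of a divisor. -/
noncomputable def degDiv (C : Curve Fq) (D : C.Point →₀ ℤ) : ℤ :=
  D.sum fun P n => (C.deg P : ℤ) * n

/-- The Riemann–Roch space `L(D)`. -/
def Lset (C : Curve Fq) (D : C.Point →₀ ℤ) : Set C.K :=
  {h | h = 0 ∨ ∀ P : C.Point, 0 ≤ C.v P h + D P}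

/-- `ℓ(D)`, the dimension of `L(D)` as an `Fq`-vector space. -/
noncomputable def ell (C : Curve Fq) (D : C.Point →₀ ℤ) : ℕ :=
  Module.finrank Fq (Submodule.span Fq (C.Lset D))

/-- The divisor `D` is principal. -/
def IsPrincipalDiv (C : Curve Fq) (D : C.Point →₀ ℤ) : Prop :=
  ∃ h : C.K, h ≠ 0 ∧ ∀ P : C.Point, C.v P h = D P

/-- The divisor `D_α = α₁Q₁ + ⋯ + α_mQ_m`. -/
noncomputable def Dt (C : Curve Fq) {m : ℕ} (Q : Fin m → C.Point) (α : Fin m → ℤ) :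
    C.Point →₀ ℤ :=
  ∑ i, Finsupp.single (Q i) (α i)

/-- The generalized Weierstrass semigroup `Ĥ(Q)`: the set of tuples
`(-v_{Q_1}(h), …, -v_{Q_m}(h))` for nonzero `h` having poles only in `{Q_1, …, Q_m}`. -/
def Hhat (C : Curve Fq) {m : ℕ} (Q : Fin m → C.Point) : Set (Fin m → ℤ) :=
  {α | ∃ h : C.K, h ≠ 0 ∧ (∀ P : C.Point, P ∉ Set.range Q → 0 ≤ C.v P h) ∧
    ∀ i, α i = -C.v (Q i) h}

/-- `∇_J(α)`. -/
def nabla (C : Curve Fq) {m : ℕ} (Q : Fin m → C.Point) (J : Set (Fin m))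
    (α : Fin m → ℤ) : Set (Fin m → ℤ) :=
  {β | β ∈ C.Hhat Q ∧ (∀ j ∈ J, β j = α j) ∧ ∀ i ∉ J, β i < α i}

/-- `∇_i^m(α)`. -/
def nablaI (C : Curve Fq) {m : ℕ} (Q : Fin m → C.Point) (i : Fin m) (α : Fin m → ℤ) :
    Set (Fin m → ℤ) :=
  {β | β ∈ C.Hhat Q ∧ β i = α i ∧ ∀ j, j ≠ i → β j ≤ α j}

/-- `Γ̂(Q)`, the set of absolute maximal elements of `Ĥ(Q)`. -/
def Gammahat (C : Curve Fq) {m : ℕ} (Q : Fin m → C.Point) : Set (Fin m → ℤ) :=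
  {α | α ∈ C.Hhat Q ∧
    ∀ J : Set (Fin m), J.Nonempty → J ≠ Set.univ → C.nabla Q J α = ∅}

/-- `Γ̂_Q(α) = {β ∈ Γ̂(Q) : β ≤ α}`. -/
def GammahatLe (C : Curve Fq) {m : ℕ} (Q : Fin m → C.Point) (α : Fin m → ℤ) :
    Set (Fin m → ℤ) :=
  {β | β ∈ C.Gammahat Q ∧ ∀ i, β i ≤ α i}

/-- The divisor `A` is a discrepancy with respect to `P` and `Q'`. -/
def IsDiscrepancy (C : Curve Fq) (A : C.Point →₀ ℤ) (P Q' : C.Point) : Prop :=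
  C.Lset A ≠ C.Lset (A - Finsupp.single Q' 1) ∧
  C.Lset (A - Finsupp.single P 1) = C.Lset (A - Finsupp.single P 1 - Finsupp.single Q' 1)

/-- `T_α = {β ∈ ℤ^m : β ≤ α and ℓ(D_β) = ℓ(D_α)}`. -/
def Tset (C : Curve Fq) {m : ℕ} (Q : Fin m → C.Point) (α : Fin m → ℤ) :
    Set (Fin m → ℤ) :=
  {β | (∀ j, β j ≤ α j) ∧ C.ell (C.Dt Q β) = C.ell (C.Dt Q α)}

/-- `D_β` is the supported floor `⌊D_α⌋_Q`: `β` is the element of `T_α` of minimum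
norm `|β| = β₁ + ⋯ + β_m`. -/
def IsSuppFloor (C : Curve Fq) {m : ℕ} (Q : Fin m → C.Point) (α β : Fin m → ℤ) : Prop :=
  β ∈ C.Tset Q α ∧ ∀ γ ∈ C.Tset Q α, ∑ i, β i ≤ ∑ i, γ i

/-- `G'` is the floor `⌊G⌋` of `G`: among all divisors with the same Riemann–Roch
space as `G`, it has minimum degree. -/
def IsFloorDiv (C : Curve Fq) (G G' : C.Point →₀ ℤ) : Prop :=
  C.Lset G' = C.Lset G ∧
  ∀ G'' : C.Point →₀ ℤ, C.Lset G'' = C.Lset G → C.degDiv G' ≤ C.degDiv G''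

end Curve

namespace Curve

variable {Fq : Type} [Field Fq]

lemma v_smul (C : Curve Fq) (P : C.Point) {c : Fq} (hc : c ≠ 0) (x : C.K) :
    C.v P (c • x) = C.v P x := by
  by_cases hx : x = 0
  · simp [hx]
  · have hc' : algebraMap Fq C.K c ≠ 0 := by simpa using hc
    rw [Algebra.smul_def, C.v_mul P hc' hx, C.v_algebraMap P c hc, zero_add]

/-- The Riemann–Roch space `L(D)` as an `Fq`-subspace of the function field. -/
def riemannRoch (C : Curve Fq) (D : C.Point →₀ ℤ) : Submodule Fq C.K where
  carrier := C.Lset D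
  zero_mem' := Or.inl rfl
  add_mem' := by
    intro x y hx hy
    by_cases hx0 : x = 0
    · simpa [hx0] using hy
    by_cases hy0 : y = 0
    · simpa [hy0] using hx
    by_cases hxy : x + y = 0
    · exact Or.inl hxy
    refine Or.inr fun P => ?_
    have h1 := hx.resolve_left hx0 P
    have h2 := hy.resolve_left hy0 P
    have h3 := C.v_min_le_add P hx0 hy0 hxy
    omega
  smul_mem' := by
    intro c x hx
    by_cases hc : c = 0
    · exact Or.inl (by simp [hc])
    rcases hx with rfl | hx
    · exact Or.inl (by simp)
    · exact Or.inr fun P => by rw [C.v_smul P hc]; exact hx P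

lemma mem_riemannRoch (C : Curve Fq) {D : C.Point →₀ ℤ} {x : C.K} (hx : x ≠ 0) :
    x ∈ C.riemannRoch D ↔ ∀ P, 0 ≤ C.v P x + D P :=
  ⟨fun h => h.resolve_left hx, Or.inr⟩

lemma ell_eq_finrank (C : Curve Fq) (D : C.Point →₀ ℤ) :
    C.ell D = Module.finrank Fq (C.riemannRoch D) := by
  rw [ell, show C.Lset D = (C.riemannRoch D : Set C.K) from rfl, Submodule.span_eq]

lemma riemannRoch_mono (C : Curve Fq) {D E : C.Point →₀ ℤ} (h : D ≤ E) :
    C.riemannRoch D ≤ C.riemannRoch E := by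
  rintro x (rfl | hx)
  · exact zero_mem _
  · exact Or.inr fun P => (hx P).trans (by have := h P; omega)

lemma degDiv_add (C : Curve Fq) (D E : C.Point →₀ ℤ) :
    C.degDiv (D + E) = C.degDiv D + C.degDiv E :=
  Finsupp.sum_add_index' (by simp) (by intros; ring)

lemma degDiv_single (C : Curve Fq) (P : C.Point) (n : ℤ) :
    C.degDiv (Finsupp.single P n) = C.deg P * n := by
  simp [degDiv]

lemma degDiv_sub (C : Curve Fq) (D E : C.Point →₀ ℤ) :
    C.degDiv (D - E) = C.degDiv D - C.degDiv E := by
  have := C.degDiv_add (D - E) E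
  rw [sub_add_cancel] at this
  omega

lemma degDiv_nonneg_of_mem (C : Curve Fq) {D : C.Point →₀ ℤ} {x : C.K} (hx : x ≠ 0)
    (h : x ∈ C.riemannRoch D) : 0 ≤ C.degDiv D := by
  rw [C.mem_riemannRoch hx] at h
  set S := D.support ∪ (C.support_finite hx).toFinset
  have hD : C.degDiv D = ∑ P ∈ S, (C.deg P : ℤ) * D P :=
    Finsupp.sum_of_support_subset _ Finset.subset_union_left _ (by simp)
  have hv : ∑ P ∈ S, (C.deg P : ℤ) * C.v P x = 0 := by
    rw [← C.degree_principal hx]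
    refine (finsum_eq_sum_of_support_subset _ fun P hP => ?_).symm
    have hP' : C.v P x ≠ 0 := right_ne_zero_of_mul hP
    simp [S, hP']
  calc 0 ≤ ∑ P ∈ S, (C.deg P : ℤ) * (C.v P x + D P) :=
        Finset.sum_nonneg fun P _ => mul_nonneg (Int.natCast_nonneg _) (h P)
    _ = C.degDiv D := by simp_rw [mul_add]; rw [Finset.sum_add_distrib, hv, hD, zero_add]

lemma ell_eq_zero_of_degDiv_neg (C : Curve Fq) {D : C.Point →₀ ℤ} (h : C.degDiv D < 0) :
    C.ell D = 0 := by
  have : C.riemannRoch D = ⊥ := by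
    rw [eq_bot_iff]
    intro x hx
    by_contra hx0
    exact absurd (C.degDiv_nonneg_of_mem hx0 hx) (by omega)
  rw [ell_eq_finrank, this, finrank_bot]

/-- Riemann–Roch forces `L(D)` to be finite-dimensional: `D` is bounded by a divisor of large
degree, whose Riemann–Roch space has positive `finrank`. -/
lemma finiteDimensional_riemannRoch (C : Curve Fq) {K₀ : C.Point →₀ ℤ}
    (hRR : ∀ D : C.Point →₀ ℤ,
      (C.ell D : ℤ) - C.ell (K₀ - D) = C.degDiv D + 1 - C.genus)
    {P : C.Point} (hP : C.deg P = 1) (D : C.Point →₀ ℤ) :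
    FiniteDimensional Fq (C.riemannRoch D) := by
  set n : ℤ := |C.degDiv D| + |C.degDiv K₀| + C.genus + 1
  have h1 := le_abs_self (C.degDiv K₀)
  have h2 := neg_abs_le (C.degDiv D)
  have h3 := abs_nonneg (C.degDiv D)
  have h4 := abs_nonneg (C.degDiv K₀)
  set E := D + Finsupp.single P n
  have hE : C.degDiv E = C.degDiv D + n := by simp [E, degDiv_add, degDiv_single, hP]
  have hKE : C.ell (K₀ - E) = 0 :=
    C.ell_eq_zero_of_degDiv_neg (by rw [degDiv_sub, hE]; omega)
  have hpos : 0 < C.ell E := by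
    have := hRR E
    rw [hKE, hE] at this
    omega
  rw [ell_eq_finrank] at hpos
  have : FiniteDimensional Fq (C.riemannRoch E) := Module.finite_of_finrank_pos hpos
  refine Submodule.finiteDimensional_of_le (C.riemannRoch_mono (D := D) (E := E) ?_)
  exact le_add_of_nonneg_right (a := D) (by rw [Finsupp.single_nonneg]; omega)

lemma ell_le_ell_sub_single_add_one (C : Curve Fq) {K₀ : C.Point →₀ ℤ}
    (hRR : ∀ D : C.Point →₀ ℤ,
      (C.ell D : ℤ) - C.ell (K₀ - D) = C.degDiv D + 1 - C.genus)
    {P : C.Point} (hP : C.deg P = 1) (D : C.Point →₀ ℤ) :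
    C.ell D ≤ C.ell (D - Finsupp.single P 1) + 1 := by
  have h1 := hRR D
  have h2 := hRR (D - Finsupp.single P 1)
  have h3 : C.ell (K₀ - D) ≤ C.ell (K₀ - (D - Finsupp.single P 1)) := by
    have := C.finiteDimensional_riemannRoch hRR hP (K₀ - (D - Finsupp.single P 1))
    rw [ell_eq_finrank, ell_eq_finrank]
    refine Submodule.finrank_mono (C.riemannRoch_mono (sub_le_sub_left ?_ _))
    exact sub_le_self _ (by simp)
  rw [degDiv_sub, degDiv_single, hP] at h2
  push_cast at h2
  omega

/-- At a rational point the leading term of one function can be cancelled by a multiple of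
another function attaining the pole order. -/
lemma exists_sub_smul_mem (C : Curve Fq) {K₀ : C.Point →₀ ℤ}
    (hRR : ∀ D : C.Point →₀ ℤ,
      (C.ell D : ℤ) - C.ell (K₀ - D) = C.degDiv D + 1 - C.genus)
    {P : C.Point} (hP : C.deg P = 1) {D : C.Point →₀ ℤ} {f h : C.K}
    (hf : f ∈ C.riemannRoch D) (hfP : f ∉ C.riemannRoch (D - Finsupp.single P 1))
    (hh : h ∈ C.riemannRoch D) :
    ∃ c : Fq, h - c • f ∈ C.riemannRoch (D - Finsupp.single P 1) := by
  set W := C.riemannRoch (D - Finsupp.single P 1)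
  have := C.finiteDimensional_riemannRoch hRR hP D
  have hWD : W ≤ C.riemannRoch D := C.riemannRoch_mono (sub_le_self _ (by simp))
  have hle : W ⊔ Submodule.span Fq {f} ≤ C.riemannRoch D :=
    sup_le hWD (by simpa [Submodule.span_le] using hf)
  have := Submodule.finiteDimensional_of_le hle
  have hlt : W < W ⊔ Submodule.span Fq {f} :=
    lt_of_le_of_ne le_sup_left fun he => hfP <| by
      rw [he]
      exact Submodule.mem_sup_right (Submodule.mem_span_singleton_self f)
  have h1 := Submodule.finrank_lt_finrank_of_lt hlt
  have h2 := C.ell_le_ell_sub_single_add_one hRR hP D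
  rw [ell_eq_finrank, ell_eq_finrank, show C.riemannRoch (D - Finsupp.single P 1) = W from rfl] at h2
  have heq := Submodule.eq_of_le_of_finrank_le hle (by omega)
  rw [← heq] at hh
  obtain ⟨w, hw, y, hy, rfl⟩ := Submodule.mem_sup.mp hh
  obtain ⟨c, rfl⟩ := Submodule.mem_span_singleton.mp hy
  exact ⟨c, by simpa using hw⟩

lemma Dt_apply (C : Curve Fq) {m : ℕ} {Q : Fin m → C.Point} (hQ : Function.Injective Q)
    (α : Fin m → ℤ) (i : Fin m) : C.Dt Q α (Q i) = α i := by
  simp [Dt, Finsupp.finsetSum_apply, Finsupp.single_apply, hQ.eq_iff]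

lemma Dt_apply_of_notMem (C : Curve Fq) {m : ℕ} {Q : Fin m → C.Point} (α : Fin m → ℤ)
    {P : C.Point} (hP : P ∉ Set.range Q) : C.Dt Q α P = 0 := by
  rw [Dt, Finsupp.finsetSum_apply]
  exact Finset.sum_eq_zero fun i _ => Finsupp.single_eq_of_ne fun h => hP ⟨i, h.symm⟩

lemma mem_riemannRoch_Dt (C : Curve Fq) {m : ℕ} {Q : Fin m → C.Point}
    (hQ : Function.Injective Q) {α : Fin m → ℤ} {x : C.K} (hx : x ≠ 0) :
    x ∈ C.riemannRoch (C.Dt Q α) ↔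
      (∀ P, P ∉ Set.range Q → 0 ≤ C.v P x) ∧ ∀ i, -C.v (Q i) x ≤ α i := by
  rw [C.mem_riemannRoch hx]
  constructor
  · intro h
    refine ⟨fun P hP => ?_, fun i => ?_⟩
    · simpa [C.Dt_apply_of_notMem α hP] using h P
    · have := h (Q i)
      rw [C.Dt_apply hQ] at this
      omega
  · rintro ⟨h1, h2⟩ P
    by_cases hP : P ∈ Set.range Q
    · obtain ⟨i, rfl⟩ := hP
      have := h2 i
      rw [C.Dt_apply hQ]
      omega
    · simpa [C.Dt_apply_of_notMem α hP] using h1 P hP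

lemma mem_riemannRoch_Dt_sub_single (C : Curve Fq) {m : ℕ} {Q : Fin m → C.Point}
    (hQ : Function.Injective Q) {α : Fin m → ℤ} (i : Fin m) {x : C.K} (hx : x ≠ 0) :
    x ∈ C.riemannRoch (C.Dt Q α - Finsupp.single (Q i) 1) ↔
      x ∈ C.riemannRoch (C.Dt Q α) ∧ -C.v (Q i) x < α i := by
  rw [C.mem_riemannRoch hx, C.mem_riemannRoch hx]
  simp only [Finsupp.sub_apply, Finsupp.single_apply]
  constructor
  · intro h
    refine ⟨fun P => ?_, ?_⟩
    · have := h P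
      split_ifs at this <;> omega
    · have := h (Q i)
      rw [C.Dt_apply hQ, if_pos rfl] at this
      omega
  · rintro ⟨h1, h2⟩ P
    split_ifs with hP
    · subst hP
      rw [C.Dt_apply hQ]
      omega
    · simpa using h1 P

lemma Dt_sub_sum_single (C : Curve Fq) {m : ℕ} (Q : Fin m → C.Point) (α : Fin m → ℤ) :
    C.Dt Q α - ∑ i, Finsupp.single (Q i) 1 = C.Dt Q fun i => α i - 1 := by
  simp only [Dt, Finsupp.single_sub, Finset.sum_sub_distrib]

lemma Dt_sub_sum_single_le (C : Curve Fq) {m : ℕ} (Q : Fin m → C.Point) (α : Fin m → ℤ)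
    (i : Fin m) :
    C.Dt Q α - ∑ i, Finsupp.single (Q i) 1 ≤ C.Dt Q α - Finsupp.single (Q i) 1 :=
  sub_le_sub_left
    (Finset.single_le_sum (f := fun i => Finsupp.single (Q i) (1 : ℤ))
      (fun _ _ => by simp) (Finset.mem_univ i)) _

end Curve

/-- Proposition 2.3: assume `q ≥ m` and let `α ∈ Ĥ(Q)`.  The
following are equivalent: (i) `α ∈ Γ̂(Q)`; (ii) `∇_i^m(α) = {α}` for all `i`;
(iii) `∇_i^m(α) = {α}` for some `i`; (iv) `ℓ(D_α) = ℓ(D_α - Q_1 - ⋯ - Q_m) + 1`. -/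
theorem statement17 {Fq : Type} [Field Fq] [Fintype Fq] (C : Curve Fq)
    (hgenus : 0 < C.genus) (K₀ : C.Point →₀ ℤ)
    (hRR : ∀ D : C.Point →₀ ℤ,
      (C.ell D : ℤ) - C.ell (K₀ - D) = C.degDiv D + 1 - C.genus)
    {m : ℕ} (hm : 2 ≤ m) (Q : Fin m → C.Point)
    (hQinj : Function.Injective Q) (hQdeg : ∀ i, C.deg (Q i) = 1)
    (hq : m ≤ Fintype.card Fq) (α : Fin m → ℤ) (hα : α ∈ C.Hhat Q) :
    List.TFAE [α ∈ C.Gammahat Q,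
      ∀ i : Fin m, C.nablaI Q i α = {α},
      ∃ i : Fin m, C.nablaI Q i α = {α},
      C.ell (C.Dt Q α) =
        C.ell (C.Dt Q α - ∑ i, Finsupp.single (Q i) 1) + 1] := by
  rw [C.Dt_sub_sum_single]
  obtain ⟨h, h0, hreg, hval⟩ := id hα
  have hfin := C.finiteDimensional_riemannRoch hRR (hQdeg ⟨0, by omega⟩)
  have hhD : h ∈ C.riemannRoch (C.Dt Q α) :=
    (C.mem_riemannRoch_Dt hQinj h0).mpr ⟨hreg, fun i => (hval i).ge⟩
  have hhi : ∀ i, h ∉ C.riemannRoch (C.Dt Q α - Finsupp.single (Q i) 1) := fun i hi =>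
    absurd ((C.mem_riemannRoch_Dt_sub_single hQinj i h0).mp hi).2 (hval i).not_gt
  have hlt : ∀ i, C.ell (C.Dt Q α - Finsupp.single (Q i) 1) < C.ell (C.Dt Q α) := fun i => by
    rw [C.ell_eq_finrank, C.ell_eq_finrank]
    have := hfin (C.Dt Q α)
    refine Submodule.finrank_lt_finrank_of_lt (SetLike.lt_iff_le_and_exists.mpr
      ⟨C.riemannRoch_mono (sub_le_self _ (by simp)), h, hhD, hhi i⟩)
  have hsub : ∀ i, C.riemannRoch (C.Dt Q fun i => α i - 1) ≤
      C.riemannRoch (C.Dt Q α - Finsupp.single (Q i) 1) := fun i => by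
    rw [← C.Dt_sub_sum_single]
    exact C.riemannRoch_mono (C.Dt_sub_sum_single_le Q α i)
  tfae_have 1 → 2 := by
    rintro ⟨-, hmax⟩ i
    refine Set.eq_singleton_iff_unique_mem.mpr ⟨⟨hα, rfl, fun _ _ => le_rfl⟩, ?_⟩
    rintro β ⟨hβ, hβi, hβj⟩
    by_contra hne
    have hle : ∀ j, β j ≤ α j := fun j => by
      by_cases hj : j = i
      · exact hj ▸ hβi.le
      · exact hβj j hj
    have hmem : β ∈ C.nabla Q {j | β j = α j} α :=
      ⟨hβ, fun j hj => hj, fun j hj => lt_of_le_of_ne (hle j) hj⟩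
    exact (hmax {j | β j = α j} ⟨i, hβi⟩
      fun hu => hne (funext fun j => Set.eq_univ_iff_forall.mp hu j)).le hmem
  tfae_have 2 → 3 := fun h2 => ⟨⟨0, by omega⟩, h2 _⟩
  tfae_have 3 → 4 := by
    rintro ⟨i, hi⟩
    have heq : C.riemannRoch (C.Dt Q fun i => α i - 1) =
        C.riemannRoch (C.Dt Q α - Finsupp.single (Q i) 1) := by
      refine le_antisymm (hsub i) fun f hf => ?_
      by_cases hf0 : f = 0
      · exact hf0 ▸ zero_mem _
      have hfD := ((C.mem_riemannRoch_Dt_sub_single hQinj i hf0).mp hf).1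
      refine (C.mem_riemannRoch_Dt hQinj hf0).mpr
        ⟨((C.mem_riemannRoch_Dt hQinj hf0).mp hfD).1, fun j => ?_⟩
      by_contra hj
      have hfj : f ∉ C.riemannRoch (C.Dt Q α - Finsupp.single (Q j) 1) := fun hf' => by
        have := ((C.mem_riemannRoch_Dt_sub_single hQinj j hf0).mp hf').2
        omega
      obtain ⟨c, hc⟩ := C.exists_sub_smul_mem hRR (hQdeg j) hfD hfj hhD
      have hci : h - c • f ∉ C.riemannRoch (C.Dt Q α - Finsupp.single (Q i) 1) := fun hw =>
        hhi i (by simpa using add_mem hw (Submodule.smul_mem _ c hf))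
      have hc0 : h - c • f ≠ 0 := fun hz => hci (hz ▸ zero_mem _)
      obtain ⟨hcD, hcj⟩ := (C.mem_riemannRoch_Dt_sub_single hQinj j hc0).mp hc
      rw [C.mem_riemannRoch_Dt_sub_single hQinj i hc0] at hci
      obtain ⟨hcreg, hcle⟩ := (C.mem_riemannRoch_Dt hQinj hc0).mp hcD
      have hmem : (fun k => -C.v (Q k) (h - c • f)) ∈ C.nablaI Q i α :=
        ⟨⟨_, hc0, hcreg, fun _ => rfl⟩,
          le_antisymm (hcle i) (not_lt.mp fun hlt' => hci ⟨hcD, hlt'⟩), fun k _ => hcle k⟩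
      rw [hi] at hmem
      exact hcj.ne (congrFun hmem j)
    have h1 := hlt i
    have h2 := C.ell_le_ell_sub_single_add_one hRR (hQdeg i) (C.Dt Q α)
    have h3 : C.ell (C.Dt Q fun i => α i - 1) = C.ell (C.Dt Q α - Finsupp.single (Q i) 1) := by
      rw [C.ell_eq_finrank, C.ell_eq_finrank, heq]
    omega
  tfae_have 4 → 1 := by
    intro h4
    refine ⟨hα, fun J ⟨j, hj⟩ hJ => Set.eq_empty_of_forall_notMem ?_⟩
    rintro β ⟨⟨f, hf0, hfreg, hfval⟩, hβJ, hβlt⟩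
    obtain ⟨i, hi⟩ := (Set.ne_univ_iff_exists_notMem J).mp hJ
    have hfD : f ∈ C.riemannRoch (C.Dt Q α) := by
      refine (C.mem_riemannRoch_Dt hQinj hf0).mpr ⟨hfreg, fun k => ?_⟩
      rw [← hfval k]
      by_cases hk : k ∈ J
      · exact (hβJ k hk).le
      · exact (hβlt k hk).le
    have hfi : f ∈ C.riemannRoch (C.Dt Q α - Finsupp.single (Q i) 1) :=
      (C.mem_riemannRoch_Dt_sub_single hQinj i hf0).mpr ⟨hfD, hfval i ▸ hβlt i hi⟩
    have hfn : f ∉ C.riemannRoch (C.Dt Q fun i => α i - 1) := fun hf => by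
      have h1 := ((C.mem_riemannRoch_Dt hQinj hf0).mp hf).2 j
      have h2 := hβJ j hj
      have h3 := hfval j
      omega
    have hlt' : C.ell (C.Dt Q fun i => α i - 1) < C.ell (C.Dt Q α - Finsupp.single (Q i) 1) := by
      rw [C.ell_eq_finrank, C.ell_eq_finrank]
      have := hfin (C.Dt Q α - Finsupp.single (Q i) 1)
      exact Submodule.finrank_lt_finrank_of_lt
        (SetLike.lt_iff_le_and_exists.mpr ⟨hsub i, f, hfi, hfn⟩)
    have := hlt i
    omega
  tfae_finish
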